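/- Let m, n ≥ 3. The sparing number of the cartesian product C_m × C_n of the cycles C_m and C_n is: 0 if both m and n are even; 2n if m is odd and n is even; and 2·max(m,n) if both m and n are odd. -/

import Mathlib

open Finset SimpleGraph
open scoped Pointwise

/-- `f` is a weak integer additive set-indexer (weak IASI) of the simple graph `G`:
an injective assignment of nonempty finite sets of non-negative integers to vertices
whose induced sumset-labeling of edges is injective, and such that the set-indexing
number of every edge equals the maximum of those of its end vertices. -/
structure IsWeakIASI {V : Type*} (G : SimpleGraph V) (f : V → Finset ℕ) : Prop where
  nonempty : ∀ v : V, (f v).Nonempty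
  injective : Function.Injective f
  edgeInjective : ∀ ⦃u v x y : V⦄, G.Adj u v → G.Adj x y →
    f u + f v = f x + f y → s(u, v) = s(x, y)
  weak : ∀ ⦃u v : V⦄, G.Adj u v → (f u + f v).card = max (f u).card (f v).card

open scoped Classical in
/-- The number of mono-indexed edges of `G` under the vertex labeling `f`, i.e. the
number of edges both of whose end vertices receive singleton set-labels. -/
noncomputable def monoEdgeCount {V : Type*} [Fintype V] (G : SimpleGraph V)
    (f : V → Finset ℕ) : ℕ :=
  (G.edgeFinset.filter fun e => ∀ v ∈ e, (f v).card = 1).card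

/-- The set of numbers of mono-indexed edges over all weak IASIs of `G`; the sparing
number of `G` is the least element of this set. -/
noncomputable def monoCounts {V : Type*} [Fintype V] (G : SimpleGraph V) : Set ℕ :=
  {k : ℕ | ∃ f : V → Finset ℕ, IsWeakIASI G f ∧ monoEdgeCount G f = k}

/-- In a weak IASI the non-singleton vertices form an independent set. -/
lemma IsWeakIASI.indep {V : Type*} {G : SimpleGraph V} {f : V → Finset ℕ}
    (hf : IsWeakIASI G f) {u v : V} (h : G.Adj u v) :
    (f u).card = 1 ∨ (f v).card = 1 := by
  have h1 := cauchy_davenport_add_of_linearOrder_isCancelAdd (hf.nonempty u) (hf.nonempty v)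
  have h2 := hf.weak h
  have h3 := (hf.nonempty u).card_pos
  have h4 := (hf.nonempty v).card_pos
  omega

open scoped Classical in
/-- Edge count in a 4-regular graph. -/
lemma monoEdgeCount_add {V : Type*} [Fintype V] (G : SimpleGraph V)
    (hreg : ∀ (v : V) [Fintype (G.neighborSet v)], G.degree v = 4) (f : V → Finset ℕ)
    (hind : ∀ u v, G.Adj u v → (f u).card = 1 ∨ (f v).card = 1) :
    monoEdgeCount G f + 4 * (univ.filter fun v => (f v).card ≠ 1).card
      = 2 * Fintype.card V := by
  have h1 := G.sum_degrees_eq_twice_card_edges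
  simp only [hreg, sum_const, card_univ, smul_eq_mul] at h1
  have h2 := Finset.card_filter_add_card_filter_not (s := G.edgeFinset)
    (fun e => ∀ v ∈ e, (f v).card = 1)
  have h3 : (G.edgeFinset.filter fun e => ¬ ∀ v ∈ e, (f v).card = 1)
      = (univ.filter fun v => (f v).card ≠ 1).biUnion fun v => G.incidenceFinset v := by
    ext e
    simp only [mem_filter, mem_edgeFinset, mem_biUnion, mem_univ, true_and,
      mem_incidenceFinset, SimpleGraph.incidenceSet, Set.mem_ofPred_eq]
    push Not
    constructor
    · rintro ⟨he, v, hv, hc⟩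
      exact ⟨v, hc, he, hv⟩
    · rintro ⟨v, hc, he, hv⟩
      exact ⟨he, v, hv, hc⟩
  have h4 : ((univ.filter fun v => (f v).card ≠ 1).biUnion fun v => G.incidenceFinset v).card
      = 4 * (univ.filter fun v => (f v).card ≠ 1).card := by
    rw [Finset.card_biUnion]
    · simp only [card_incidenceFinset_eq_degree, hreg, sum_const, smul_eq_mul]
      ring
    · intro u hu v hv huv
      have hu := (mem_filter.1 hu).2
      have hv := (mem_filter.1 hv).2
      change Disjoint (G.incidenceFinset u) (G.incidenceFinset v)
      rw [Finset.disjoint_left]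
      intro e he he'
      rw [mem_incidenceFinset] at he he'
      have : G.Adj u v := G.adj_of_mem_incidenceSet huv he he'
      rcases hind u v this with h | h
      · exact hu h
      · exact hv h
  unfold monoEdgeCount
  rw [h3, h4] at h2
  omega

lemma two_pow_pair {i j k l : ℕ} (hij : i ≠ j) (hkl : k ≠ l)
    (h : 2 ^ i + 2 ^ j = 2 ^ k + 2 ^ l) : s(i, j) = s(k, l) := by
  have := @Finset.geomSum_injective 2 le_rfl ({i, j} : Finset ℕ) {k, l}
    (by simpa [Finset.sum_pair hij, Finset.sum_pair hkl] using h)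
  have h1 : i ∈ ({k, l} : Finset ℕ) := by rw [← this]; simp
  have h2 : j ∈ ({k, l} : Finset ℕ) := by rw [← this]; simp
  simp only [mem_insert, mem_singleton] at h1 h2
  rw [Sym2.eq_iff]
  omega

open scoped Classical in
/-- Every independent set is the set of non-singleton vertices of a weak IASI. -/
lemma exists_weakIASI {V : Type*} [Fintype V] (G : SimpleGraph V) (S : Finset V)
    (hS : ∀ u v, G.Adj u v → u ∉ S ∨ v ∉ S) :
    ∃ f : V → Finset ℕ, IsWeakIASI G f ∧ ∀ v, (f v).card ≠ 1 ↔ v ∈ S := by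
  obtain ⟨e⟩ : Nonempty (V ≃ Fin (Fintype.card V)) := ⟨Fintype.equivFin V⟩
  set a : V → ℕ := fun v => 2 ^ (e v).val with ha
  set g : V → Finset ℕ := fun v => if v ∈ S then {0, 1} else {0} with hg
  set f : V → Finset ℕ := fun v => {a v} + g v with hf
  have hcard : ∀ v, (f v).card = (g v).card := fun v => by simp [hf]
  have hg0 : ∀ v, 0 ∈ g v := fun v => by simp only [hg]; split_ifs <;> simp
  have hmem : ∀ v, a v ∈ f v := fun v => by
    simp only [hf]; rw [Finset.mem_add]; exact ⟨a v, by simp, 0, hg0 v, by simp⟩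
  have hge : ∀ v, ∀ x ∈ f v, a v ≤ x := fun v x hx => by
    simp only [hf] at hx; rw [Finset.mem_add] at hx
    obtain ⟨y, hy, z, hz, rfl⟩ := hx
    simp only [mem_singleton] at hy
    omega
  have hinj : ∀ u v, a u = a v → u = v := fun u v h => by
    have := Nat.pow_right_injective le_rfl h
    exact e.injective (Fin.ext this)
  have hc1 : ∀ v, v ∉ S → (f v).card = 1 := fun v hv => by
    rw [hcard]; simp [hg, hv]
  refine ⟨f, ⟨fun v => ⟨_, hmem v⟩, ?_, ?_, ?_⟩, ?_⟩
  · intro u v huv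
    apply hinj
    apply le_antisymm
    · apply hge; rw [huv]; exact hmem v
    · apply hge; rw [← huv]; exact hmem u
  · intro u v x y huv hxy h
    have key : a u + a v = a x + a y := by
      apply le_antisymm
      · have : a x + a y ∈ f u + f v := by rw [h]; exact add_mem_add (hmem x) (hmem y)
        rw [Finset.mem_add] at this
        obtain ⟨p, hp, q, hq, h⟩ := this
        have := hge _ _ hp
        have := hge _ _ hq
        omega
      · have : a u + a v ∈ f x + f y := by rw [← h]; exact add_mem_add (hmem u) (hmem v)
        rw [Finset.mem_add] at this
        obtain ⟨p, hp, q, hq, h⟩ := this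
        have := hge _ _ hp
        have := hge _ _ hq
        omega
    have hne : ∀ {u v}, G.Adj u v → (e u).val ≠ (e v).val := fun h h' =>
      h.ne (e.injective (Fin.ext h'))
    have := two_pow_pair (hne huv) (hne hxy) key
    rw [Sym2.eq_iff] at this ⊢
    simpa [Fin.val_inj] using this
  · intro u v huv
    have pos : ∀ v, 0 < (f v).card := fun v => Finset.card_pos.2 ⟨_, hmem v⟩
    rcases hS u v huv with h | h
    · have h1 := hc1 u h
      rw [h1, max_eq_right (pos v)]
      obtain ⟨z, hz⟩ := Finset.card_eq_one.1 h1
      rw [hz]; simp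
    · have h1 := hc1 v h
      rw [h1, max_eq_left (pos u)]
      obtain ⟨z, hz⟩ := Finset.card_eq_one.1 h1
      rw [hz]; simp
  · intro v
    by_cases hv : v ∈ S
    · simp [hcard, hg, hv]
    · simp [hcard, hg, hv]

lemma torus_degree (m n : ℕ) (hm : 3 ≤ m) (hn : 3 ≤ n) (v : Fin m × Fin n)
    [Fintype ((cycleGraph m □ cycleGraph n).neighborSet v)] :
    (cycleGraph m □ cycleGraph n).degree v = 4 := by
  obtain ⟨m, rfl⟩ := Nat.exists_eq_add_of_le' hm
  obtain ⟨n, rfl⟩ := Nat.exists_eq_add_of_le' hn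
  rw [degree_boxProd, cycleGraph_degree_three_le, cycleGraph_degree_three_le]

/-- Adjacency in a cycle in terms of values. -/
lemma cyc_adj_val {n : ℕ} (hn : 3 ≤ n) (u v : Fin n) :
    (cycleGraph n).Adj u v ↔ u.val + 1 = v.val ∨ v.val + 1 = u.val ∨
      (u.val = 0 ∧ v.val + 1 = n) ∨ (v.val = 0 ∧ u.val + 1 = n) := by
  rw [cycleGraph_adj']
  have hu := u.isLt
  have hv := v.isLt
  have key : ∀ a b : Fin n, (a - b).val = if b.val ≤ a.val then a.val - b.val
      else n + a.val - b.val := by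
    intro a b
    have ha := a.isLt
    have hb := b.isLt
    rw [Fin.sub_def]
    simp only
    split_ifs with h
    · rw [show n - b.val + a.val = (a.val - b.val) + n by omega, Nat.add_mod_right,
        Nat.mod_eq_of_lt (by omega)]
    · rw [Nat.mod_eq_of_lt (by omega)]; omega
  rw [key, key]
  split_ifs <;> omega

/-- Independent sets in a cycle have at most half of the vertices. -/
lemma cyc_indep_card {n : ℕ} (hn : 3 ≤ n) (I : Finset (Fin n))
    (hI : ∀ u v, (cycleGraph n).Adj u v → u ∉ I ∨ v ∉ I) : I.card ≤ n / 2 := by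
  obtain ⟨n, rfl⟩ := Nat.exists_eq_add_of_le' hn
  have hd : Disjoint I (I.image (fun x => x + 1)) := by
    rw [Finset.disjoint_left]
    intro x hx hx'
    rw [mem_image] at hx'
    obtain ⟨y, hy, rfl⟩ := hx'
    have : (cycleGraph (n + 3)).Adj (y + 1) y := by
      rw [cycleGraph_adj]; left; simp
    rcases hI _ _ this with h | h
    · exact h hx
    · exact h hy
  have h1 := Finset.card_le_univ (I ∪ I.image (fun x => x + 1))
  rw [Finset.card_union_of_disjoint hd,
    Finset.card_image_of_injective _ (add_left_injective 1), Fintype.card_fin] at h1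
  omega

/-- Independent sets in the torus: bound by rows. -/
lemma torus_indep_card_left {m n : ℕ} (hm : 3 ≤ m) (S : Finset (Fin m × Fin n))
    (hS : ∀ u v, (cycleGraph m □ cycleGraph n).Adj u v → u ∉ S ∨ v ∉ S) :
    S.card ≤ n * (m / 2) := by
  rw [Finset.card_eq_sum_card_fiberwise (f := Prod.snd) (t := univ) (by intro x _; simp)]
  calc _ ≤ ∑ b : Fin n, m / 2 := ?_
    _ = _ := by simp
  apply Finset.sum_le_sum
  intro b _
  have h1 : (S.filter fun a => a.2 = b) ⊆
      (univ.filter fun i : Fin m => (i, b) ∈ S).image (fun i => (i, b)) := by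
    rintro ⟨i, j⟩ h
    simp only [mem_filter] at h
    obtain ⟨h, rfl⟩ := h
    simp [h]
  refine (card_le_card h1).trans (card_image_le.trans (cyc_indep_card hm _ ?_))
  intro u v huv
  simp only [mem_filter, mem_univ, true_and]
  exact hS _ _ (boxProd_adj_left.2 huv)

lemma torus_adj_swap {m n : ℕ} {u v : Fin m × Fin n}
    (h : (cycleGraph m □ cycleGraph n).Adj u v) :
    (cycleGraph n □ cycleGraph m).Adj u.swap v.swap := by
  rw [boxProd_adj] at h ⊢
  exact h.symm

lemma torus_indep_swap {m n : ℕ} (S : Finset (Fin m × Fin n))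
    (hS : ∀ u v, (cycleGraph m □ cycleGraph n).Adj u v → u ∉ S ∨ v ∉ S) :
    ∀ u v, (cycleGraph n □ cycleGraph m).Adj u v →
      u ∉ S.image Prod.swap ∨ v ∉ S.image Prod.swap := by
  have key : ∀ u : Fin n × Fin m, u ∈ S.image Prod.swap ↔ u.swap ∈ S := by
    rintro ⟨a, b⟩
    simp
  intro u v huv
  rw [key, key]
  exact hS _ _ (torus_adj_swap huv)

/-- Construction of large independent sets from a homomorphism between cycles. -/
lemma torus_exists_indep {m n : ℕ} (hm : 3 ≤ m) (h : Fin n → Fin m)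
    (hh : ∀ u v, (cycleGraph n).Adj u v → (cycleGraph m).Adj (h u) (h v)) :
    ∃ S : Finset (Fin m × Fin n), S.card = n * (m / 2) ∧
      ∀ u v, (cycleGraph m □ cycleGraph n).Adj u v → u ∉ S ∨ v ∉ S := by
  obtain ⟨k, hk⟩ : ∃ k, m = k + 3 := Nat.exists_eq_add_of_le' hm
  let g : Fin (m / 2) → Fin m := fun i => ⟨2 * i.val, by have := i.isLt; omega⟩
  have hgi : Function.Injective g := by
    intro i j hij
    simp only [g, Fin.mk.injEq] at hij
    apply Fin.ext
    omega
  let I : Finset (Fin m) := univ.image g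
  have hI : ∀ u v, (cycleGraph m).Adj u v → u ∉ I ∨ v ∉ I := by
    intro u v huv
    by_contra! hc
    simp only [I, mem_image, mem_univ, true_and] at hc
    obtain ⟨⟨i, rfl⟩, ⟨j, rfl⟩⟩ := hc
    have h1 := (cyc_adj_val hm _ _).1 huv
    simp only [g] at h1
    have := i.isLt
    have := j.isLt
    omega
  have hIc : I.card = m / 2 := by
    simp only [I]
    rw [card_image_of_injective _ hgi, card_univ, Fintype.card_fin]
  clear_value I
  subst hk
  refine ⟨univ.filter fun p => p.1 - h p.2 ∈ I, ?_, ?_⟩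
  · have : (univ.filter fun p : Fin (k + 3) × Fin n => p.1 - h p.2 ∈ I)
        = (I ×ˢ (univ : Finset (Fin n))).image (fun p => (p.1 + h p.2, p.2)) := by
      ext ⟨i, j⟩
      simp only [mem_filter, mem_univ, true_and, mem_image, mem_product, and_true,
        Prod.exists, Prod.mk.injEq]
      constructor
      · intro hi
        exact ⟨i - h j, j, hi, by simp, rfl⟩
      · rintro ⟨a, b, ha, h1, rfl⟩
        rw [← h1]; simpa using ha
    rw [this, card_image_of_injective, card_product, hIc, card_univ, Fintype.card_fin, mul_comm]
    rintro ⟨a, b⟩ ⟨c, d⟩ hh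
    simp only [Prod.mk.injEq] at hh
    obtain ⟨h1, rfl⟩ := hh
    simpa using h1
  · rintro ⟨i, j⟩ ⟨i', j'⟩ huv
    simp only [mem_filter, mem_univ, true_and]
    apply hI
    rw [boxProd_adj] at huv
    rcases huv with ⟨h1, h2⟩ | ⟨h1, h2⟩
    · simp only at h1 h2
      subst h2
      rw [cycleGraph_adj] at h1 ⊢
      simpa using h1
    · simp only at h1 h2
      subst h2
      have := hh _ _ h1
      rw [cycleGraph_adj] at this ⊢
      simpa using this.symm

lemma hom_even {m n : ℕ} (hm : 3 ≤ m) (hn : 3 ≤ n) (he : Even n) :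
    ∃ h : Fin n → Fin m,
      ∀ u v, (cycleGraph n).Adj u v → (cycleGraph m).Adj (h u) (h v) := by
  refine ⟨fun j => ⟨j.val % 2, by omega⟩, ?_⟩
  intro u v huv
  rw [cyc_adj_val hn] at huv
  rw [cyc_adj_val hm]
  simp only
  rw [Nat.even_iff] at he
  omega

lemma hom_odd {m n : ℕ} (hm : 3 ≤ m) (hmn : m ≤ n) (hmo : Odd m) (hno : Odd n) :
    ∃ h : Fin n → Fin m,
      ∀ u v, (cycleGraph n).Adj u v → (cycleGraph m).Adj (h u) (h v) := by
  refine ⟨fun j => ⟨if j.val < m then j.val else (j.val - m) % 2, by split_ifs <;> omega⟩, ?_⟩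
  intro u v huv
  rw [cyc_adj_val (hm.trans hmn)] at huv
  rw [cyc_adj_val hm]
  simp only
  rw [Nat.odd_iff] at hmo hno
  have := u.isLt
  have := v.isLt
  split_ifs <;> omega

lemma mem_monoCounts_of_indep {m n : ℕ} (hm : 3 ≤ m) (hn : 3 ≤ n)
    (S : Finset (Fin m × Fin n))
    (hS : ∀ u v, (cycleGraph m □ cycleGraph n).Adj u v → u ∉ S ∨ v ∉ S) (k : ℕ)
    (hk : k + 4 * S.card = 2 * (m * n)) :
    k ∈ monoCounts (cycleGraph m □ cycleGraph n) := by
  classical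
  obtain ⟨f, hf, hfS⟩ := exists_weakIASI _ S hS
  refine ⟨f, hf, ?_⟩
  have h1 := monoEdgeCount_add (cycleGraph m □ cycleGraph n)
    (fun v _ => torus_degree m n hm hn v) f
    (fun u v huv => hf.indep huv)
  have h2 : (univ.filter fun v => (f v).card ≠ 1) = S := by
    ext v; simpa using hfS v
  rw [Fintype.card_prod, Fintype.card_fin, Fintype.card_fin, h2] at h1
  omega

lemma exists_indep_of_mem {m n : ℕ} (hm : 3 ≤ m) (hn : 3 ≤ n) (k : ℕ)
    (hk : k ∈ monoCounts (cycleGraph m □ cycleGraph n)) :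
    ∃ s, k + 4 * s = 2 * (m * n) ∧ s ≤ n * (m / 2) ∧ s ≤ m * (n / 2) := by
  classical
  obtain ⟨f, hf, rfl⟩ := hk
  have h1 := monoEdgeCount_add (cycleGraph m □ cycleGraph n)
    (fun v _ => torus_degree m n hm hn v) f
    (fun u v huv => hf.indep huv)
  rw [Fintype.card_prod, Fintype.card_fin, Fintype.card_fin] at h1
  have hS : ∀ S : Finset (Fin m × Fin n), (∀ v, v ∈ S → (f v).card ≠ 1) →
      ∀ u v, (cycleGraph m □ cycleGraph n).Adj u v → u ∉ S ∨ v ∉ S := by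
    intro S hS u v huv
    by_contra! hc
    rcases hf.indep huv with h | h
    · exact hS u hc.1 h
    · exact hS v hc.2 h
  have hb : ∀ S : Finset (Fin m × Fin n), (∀ v, v ∈ S → (f v).card ≠ 1) →
      S.card ≤ n * (m / 2) ∧ S.card ≤ m * (n / 2) := by
    intro S hS0
    have hS' := hS S hS0
    refine ⟨torus_indep_card_left hm S hS', ?_⟩
    have := torus_indep_card_left hn _ (torus_indep_swap S hS')
    rwa [card_image_of_injective _ Prod.swap_injective] at this
  refine ⟨_, h1, hb _ ?_⟩
  intro v hv
  exact (mem_filter.1 hv).2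

/-- For `m, n ≥ 3`, the sparing number of `Cₘ □ Cₙ` is `0` if both `m`
and `n` are even, `2n` if `m` is odd and `n` is even, and `2 * max m n` if both are odd. -/
theorem sparing_number_cycle_boxProd_cycle (m n : ℕ) (hm : 3 ≤ m) (hn : 3 ≤ n) :
    (Even m → Even n → IsLeast (monoCounts (cycleGraph m □ cycleGraph n)) 0) ∧
      (Odd m → Even n → IsLeast (monoCounts (cycleGraph m □ cycleGraph n)) (2 * n)) ∧
      (Odd m → Odd n → IsLeast (monoCounts (cycleGraph m □ cycleGraph n)) (2 * max m n)) := by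
  refine ⟨fun he ho => ⟨?_, fun k _ => Nat.zero_le k⟩, fun he ho => ⟨?_, ?_⟩,
    fun he ho => ⟨?_, ?_⟩⟩
  · obtain ⟨h, hh⟩ := hom_even hm hn ho
    obtain ⟨S, hc, hS⟩ := torus_exists_indep hm h hh
    apply mem_monoCounts_of_indep hm hn S hS
    obtain ⟨a, rfl⟩ := he
    rw [hc, show (a + a) / 2 = a by omega]
    ring
  · obtain ⟨h, hh⟩ := hom_even hm hn ho
    obtain ⟨S, hc, hS⟩ := torus_exists_indep hm h hh
    apply mem_monoCounts_of_indep hm hn S hS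
    obtain ⟨a, rfl⟩ := he
    rw [hc, show (2 * a + 1) / 2 = a by omega]
    ring
  · intro k hk
    obtain ⟨s, h1, h2, -⟩ := exists_indep_of_mem hm hn k hk
    obtain ⟨a, rfl⟩ := he
    rw [show (2 * a + 1) / 2 = a by omega] at h2
    nlinarith
  · rcases le_total m n with hmn | hmn
    · obtain ⟨h, hh⟩ := hom_odd hm hmn he ho
      obtain ⟨S, hc, hS⟩ := torus_exists_indep hm h hh
      apply mem_monoCounts_of_indep hm hn S hS
      rw [max_eq_right hmn]
      obtain ⟨a, rfl⟩ := he
      rw [hc, show (2 * a + 1) / 2 = a by omega]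
      ring
    · obtain ⟨h, hh⟩ := hom_odd hn hmn ho he
      obtain ⟨S, hc, hS⟩ := torus_exists_indep hn h hh
      apply mem_monoCounts_of_indep hm hn _ (torus_indep_swap S hS)
      rw [card_image_of_injective _ Prod.swap_injective, max_eq_left hmn]
      obtain ⟨a, rfl⟩ := ho
      rw [hc, show (2 * a + 1) / 2 = a by omega]
      ring
  · intro k hk
    obtain ⟨s, h1, h2, h3⟩ := exists_indep_of_mem hm hn k hk
    obtain ⟨a, rfl⟩ := he
    obtain ⟨b, rfl⟩ := ho
    rw [show (2 * a + 1) / 2 = a by omega] at h2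
    rw [show (2 * b + 1) / 2 = b by omega] at h3
    rcases le_total (2 * a + 1) (2 * b + 1) with hmn | hmn
    · rw [max_eq_right hmn]; nlinarith
    · rw [max_eq_left hmn]; nlinarith
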